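/- arXiv:1907.13297 — 12 statements merged into one kernel-verified Lean document; each statement's English description precedes it below -/
import Mathlib

section
/- Let A > 1, H > 0 and SSR > 0. For every G > 0 and K < 0 with (A + H·G·K)² < 1, one has SNR(G,K) = K²·(G² + SSR)/(1 − (A + H·G·K)²) > (A² − 1)/H², and for every ε > 0 there exist such (G,K) with SNR(G,K) < (A² − 1)/H² + ε (the infimum is approached with G·K = −(A² − 1)/(A·H) and K → 0⁻). Consequently, for any γ0 > 0 the feasible set {(G,K) : G > 0, K < 0, (A + H·G·K)² < 1, SNR(G,K) ≤ γ0} is nonempty if and only if (A² − 1)/H² < γ0. -/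
/-- Feasibility of the slow-fading single-plant coding-free control problem (S1):
the SNR `K² (G² + SSR) / (1 - (A + H G K)²)` over the stable region is bounded below
by `(A² - 1)/H²`, this bound is approached arbitrarily closely, and hence the feasible
set is nonempty iff `(A² - 1)/H² < γ0`. -/
theorem stmt1 (A H SSR γ0 : ℝ) (hA : 1 < A) (hH : 0 < H) (hSSR : 0 < SSR)
    (hγ0 : 0 < γ0) :
    (∀ G K : ℝ, 0 < G → K < 0 → (A + H * G * K) ^ 2 < 1 →
        (A ^ 2 - 1) / H ^ 2 < K ^ 2 * (G ^ 2 + SSR) / (1 - (A + H * G * K) ^ 2)) ∧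
    (∀ ε : ℝ, 0 < ε → ∃ G K : ℝ, 0 < G ∧ K < 0 ∧ (A + H * G * K) ^ 2 < 1 ∧
        K ^ 2 * (G ^ 2 + SSR) / (1 - (A + H * G * K) ^ 2) < (A ^ 2 - 1) / H ^ 2 + ε) ∧
    ((∃ G K : ℝ, 0 < G ∧ K < 0 ∧ (A + H * G * K) ^ 2 < 1 ∧
        K ^ 2 * (G ^ 2 + SSR) / (1 - (A + H * G * K) ^ 2) ≤ γ0) ↔
      (A ^ 2 - 1) / H ^ 2 < γ0) := by
  have h1 : ∀ G K : ℝ, 0 < G → K < 0 → (A + H * G * K) ^ 2 < 1 →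
        (A ^ 2 - 1) / H ^ 2 < K ^ 2 * (G ^ 2 + SSR) / (1 - (A + H * G * K) ^ 2) := by
    intro G K hG hK h
    rw [div_lt_div_iff₀ (by positivity) (by linarith)]
    have hp : 0 < K ^ 2 * SSR * H ^ 2 :=
      mul_pos (mul_pos (by nlinarith) hSSR) (by positivity)
    nlinarith [sq_nonneg (A * (H * G * K) + A ^ 2 - 1)]
  have h2 : ∀ ε : ℝ, 0 < ε → ∃ G K : ℝ, 0 < G ∧ K < 0 ∧ (A + H * G * K) ^ 2 < 1 ∧
        K ^ 2 * (G ^ 2 + SSR) / (1 - (A + H * G * K) ^ 2) < (A ^ 2 - 1) / H ^ 2 + ε := by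
    intro ε hε
    have hA0 : 0 < A := by linarith
    have hA2 : 0 < A ^ 2 - 1 := by nlinarith
    obtain ⟨t, ht, hts⟩ : ∃ t : ℝ, 0 < t ∧ t ^ 2 = ε * (A ^ 2 - 1) / (2 * SSR * A ^ 2) :=
      ⟨√(ε * (A ^ 2 - 1) / (2 * SSR * A ^ 2)), Real.sqrt_pos.mpr (by positivity),
        Real.sq_sqrt (by positivity)⟩
    have hy : A + H * ((A ^ 2 - 1) / (A * H * t)) * (-t) = 1 / A := by
      field_simp
      ring
    have hlt : (1 / A) ^ 2 < 1 := by
      rw [div_pow, one_pow, div_lt_one (by positivity)]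
      linarith
    refine ⟨(A ^ 2 - 1) / (A * H * t), -t, by positivity, by linarith, ?_, ?_⟩
    · rw [hy]; exact hlt
    · rw [hy]
      have e1 : (-t) ^ 2 * (((A ^ 2 - 1) / (A * H * t)) ^ 2 + SSR)
          = (A ^ 2 - 1) ^ 2 / (A ^ 2 * H ^ 2) + t ^ 2 * SSR := by
        field_simp
      have e2 : ((A ^ 2 - 1) / H ^ 2 + ε) * (1 - (1 / A) ^ 2)
          = (A ^ 2 - 1) ^ 2 / (A ^ 2 * H ^ 2) + ε * (A ^ 2 - 1) / A ^ 2 := by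
        field_simp
      have e3 : ε * (A ^ 2 - 1) / (2 * SSR * A ^ 2) * SSR = ε * (A ^ 2 - 1) / A ^ 2 / 2 := by
        field_simp
      have e4 : 0 < ε * (A ^ 2 - 1) / A ^ 2 := by positivity
      rw [div_lt_iff₀ (by linarith), e1, e2, hts, e3]
      linarith
  refine ⟨h1, h2, ?_, ?_⟩
  · rintro ⟨G, K, hG, hK, h, hle⟩
    exact (h1 G K hG hK h).trans_le hle
  · intro h
    obtain ⟨G, K, hG, hK, hs, hl⟩ := h2 (γ0 - (A ^ 2 - 1) / H ^ 2) (by linarith)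
    exact ⟨G, K, hG, hK, hs, by linarith⟩
end

section
/- Let A > 1, H > 0, σ_z > 0, σ_w > 0, γ0 > 0, SSR = σ_w²/σ_z², and fix a ∈ (−1, 1) such that B := ((1 − a²)·γ0 − (a − A)²/H²)/SSR > 0. For K < 0 with K² ≤ B, set G = (a − A)/(H·K) (so that A + H·G·K = a). Then the SNR constraint K²·(((a − A)/(H·K))² + SSR)/(1 − a²) ≤ γ0 holds, and the cost J(K) = (((a − A)/(H·K))²·σ_z² + σ_w²)/(1 − a²) is minimized at K = −√B, with minimum value H²·γ0·σ_w²/(H²·γ0·(1 − a²) − (a − A)²). -/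
/-- Inner optimization step (S1-1): with the closed-loop parameter fixed at `a`,
for `K < 0` with `K² ≤ B` and `G = (a - A)/(H K)`, the SNR constraint holds and the
cost is minimized at `K = -√B`, with the stated minimum value. -/
theorem stmt2 (A H σz σw γ0 a SSR B : ℝ) (hA : 1 < A) (hH : 0 < H) (hσz : 0 < σz)
    (hσw : 0 < σw) (hγ0 : 0 < γ0) (ha : a ∈ Set.Ioo (-1 : ℝ) 1)
    (hSSR : SSR = σw ^ 2 / σz ^ 2)
    (hB : B = ((1 - a ^ 2) * γ0 - (a - A) ^ 2 / H ^ 2) / SSR) (hBpos : 0 < B) :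
    (∀ K : ℝ, K < 0 → K ^ 2 ≤ B →
      K ^ 2 * (((a - A) / (H * K)) ^ 2 + SSR) / (1 - a ^ 2) ≤ γ0 ∧
      (((a - A) / (H * (-Real.sqrt B))) ^ 2 * σz ^ 2 + σw ^ 2) / (1 - a ^ 2) ≤
        (((a - A) / (H * K)) ^ 2 * σz ^ 2 + σw ^ 2) / (1 - a ^ 2)) ∧
    (((a - A) / (H * (-Real.sqrt B))) ^ 2 * σz ^ 2 + σw ^ 2) / (1 - a ^ 2) =
      H ^ 2 * γ0 * σw ^ 2 / (H ^ 2 * γ0 * (1 - a ^ 2) - (a - A) ^ 2) := by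
  obtain ⟨h1, h2⟩ := ha
  have hn : 0 < 1 - a ^ 2 := by nlinarith
  have hS : 0 < SSR := by rw [hSSR]; positivity
  have hBS : B * SSR = (1 - a ^ 2) * γ0 - (a - A) ^ 2 / H ^ 2 := by
    rw [hB]; field_simp
  have hsq : ((a - A) / (H * (-Real.sqrt B))) ^ 2 = (a - A) ^ 2 / (H ^ 2 * B) := by
    rw [div_pow, mul_pow, neg_sq, Real.sq_sqrt hBpos.le]
  rw [hsq]
  refine ⟨fun K hK hKB => ⟨?_, ?_⟩, ?_⟩
  · rw [div_le_iff₀ hn]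
    have e : K ^ 2 * (((a - A) / (H * K)) ^ 2 + SSR) = (a - A) ^ 2 / H ^ 2 + K ^ 2 * SSR := by
      have hK0 : K ≠ 0 := hK.ne
      field_simp
    rw [e]
    nlinarith [mul_le_mul_of_nonneg_right hKB hS.le]
  · have hK2 : 0 < K ^ 2 := by have := hK.ne; positivity
    rw [div_pow (a - A) (H * K), mul_pow H K]
    gcongr
  · have hD : H ^ 2 * γ0 * (1 - a ^ 2) - (a - A) ^ 2 = H ^ 2 * B * (σw ^ 2 / σz ^ 2) := by
      rw [← hSSR, mul_assoc (H ^ 2) B, hBS]; field_simp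
    have hc : (a - A) ^ 2 = H ^ 2 * γ0 * (1 - a ^ 2) - H ^ 2 * B * (σw ^ 2 / σz ^ 2) := by
      linarith
    rw [hD, hc]
    have := hn.ne'
    field_simp
    ring
end

section
/- Let A > 1, H > 0, γ0 > 0 with A² < 1 + H²·γ0, and σ_w > 0. On the set D = {a ∈ (−1, 1) : H²·γ0·(1 − a²) − (a − A)² > 0}, the function ψ(a) = H²·γ0·σ_w²/(H²·γ0·(1 − a²) − (a − A)²) attains its minimum uniquely at a* = A/(1 + H²·γ0); moreover a* ∈ (0, 1) ∩ D and ψ(a*) = σ_w²·(1 + H²·γ0)/(1 + H²·γ0 − A²). -/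
/-- Outer optimization step (S1-2): the function
`ψ(a) = H²γ0σw² / (H²γ0(1 - a²) - (a - A)²)` on
`D = {a ∈ (-1,1) : H²γ0(1 - a²) - (a - A)² > 0}` attains its minimum uniquely at
`a* = A/(1 + H²γ0)`, which lies in `(0,1) ∩ D`, with the stated minimum value. -/
theorem stmt3 (A H γ0 σw : ℝ) (hA : 1 < A) (hH : 0 < H) (hγ0 : 0 < γ0)
    (hfeas : A ^ 2 < 1 + H ^ 2 * γ0) (hσw : 0 < σw)
    (D : Set ℝ)
    (hD : D = {a | a ∈ Set.Ioo (-1 : ℝ) 1 ∧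
      0 < H ^ 2 * γ0 * (1 - a ^ 2) - (a - A) ^ 2})
    (ψ : ℝ → ℝ)
    (hψ : ∀ a, ψ a = H ^ 2 * γ0 * σw ^ 2 / (H ^ 2 * γ0 * (1 - a ^ 2) - (a - A) ^ 2))
    (astar : ℝ) (hastar : astar = A / (1 + H ^ 2 * γ0)) :
    astar ∈ Set.Ioo (0 : ℝ) 1 ∧ astar ∈ D ∧
    ψ astar = σw ^ 2 * (1 + H ^ 2 * γ0) / (1 + H ^ 2 * γ0 - A ^ 2) ∧
    (∀ a ∈ D, ψ astar ≤ ψ a) ∧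
    (∀ a ∈ D, a ≠ astar → ψ astar < ψ a) := by
  have hP : 0 < H ^ 2 * γ0 := by positivity
  generalize H ^ 2 * γ0 = P at *
  have hQ : 0 < 1 + P := by linarith
  have hs : astar * (1 + P) = A := by rw [hastar]; field_simp
  have hR : 0 < 1 + P - A ^ 2 := by linarith
  have hval : P * (1 - astar ^ 2) - (astar - A) ^ 2 = P * (1 + P - A ^ 2) / (1 + P) := by
    rw [hastar]; field_simp; ring
  have hpos : 0 < P * (1 - astar ^ 2) - (astar - A) ^ 2 := by
    rw [hval]; positivity
  have h0 : 0 < astar := by rw [hastar]; positivity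
  have h1 : astar < 1 := by rw [hastar, div_lt_one hQ]; nlinarith
  have hdiff : ∀ a, P * (1 - a ^ 2) - (a - A) ^ 2
      = P * (1 - astar ^ 2) - (astar - A) ^ 2 - (1 + P) * (a - astar) ^ 2 := by
    intro a; rw [← hs]; ring
  have hlt : ∀ a ∈ D, a ≠ astar → ψ astar < ψ a := by
    intro a ha hne
    rw [hD] at ha
    rw [hψ, hψ]
    apply div_lt_div_of_pos_left (by positivity) ha.2
    have : 0 < (a - astar) ^ 2 := by
      have := sub_ne_zero.mpr hne
      positivity
    have := mul_pos hQ this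
    linarith [hdiff a]
  refine ⟨⟨h0, h1⟩, ?_, ?_, ?_, hlt⟩
  · rw [hD]; exact ⟨⟨by linarith, h1⟩, hpos⟩
  · rw [hψ, hval]; field_simp
  · intro a ha
    by_cases h : a = astar
    · rw [h]
    · exact (hlt a ha h).le
end

section
/- (Theorem 1.) Let A > 1, H > 0, σ_z > 0, σ_w > 0, γ0 > 0, SSR = σ_w²/σ_z², and assume the feasibility condition A² < 1 + H²·γ0. Set K* = −√((γ0/SSR)·(H²·γ0 + 1 − A²)/(H²·γ0 + 1)) and G* = A·H·√(γ0·SSR/((H²·γ0 + 1)·(H²·γ0 + 1 − A²))). Then G* > 0, K* < 0, A + H·G*·K* = A/(1 + H²·γ0) ∈ (0, 1), SNR(G*,K*) = γ0, and for every (G,K) with G > 0, K < 0, (A + H·G·K)² < 1 and SNR(G,K) ≤ γ0 one has J(G,K) ≥ J(G*,K*) = σ_w²·(1 + H²·γ0)/(1 + H²·γ0 − A²). -/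
/-- Theorem 1 of the paper: in the slow-fading single-plant scenario under the
feasibility condition `A² < 1 + H²γ0`, the stated `(G*, K*)` is feasible, meets the
SNR budget with equality, yields the closed-loop parameter `A/(1 + H²γ0) ∈ (0,1)`,
and minimizes the steady-state cost `J(G,K) = (G²σz² + σw²)/(1 - (A + HGK)²)` over
all feasible `(G,K)`, with minimum value `σw²(1 + H²γ0)/(1 + H²γ0 - A²)`. -/
theorem stmt4 (A H σz σw γ0 SSR Kstar Gstar : ℝ) (hA : 1 < A) (hH : 0 < H)
    (hσz : 0 < σz) (hσw : 0 < σw) (hγ0 : 0 < γ0)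
    (hSSR : SSR = σw ^ 2 / σz ^ 2)
    (hfeas : A ^ 2 < 1 + H ^ 2 * γ0)
    (hK : Kstar = -Real.sqrt ((γ0 / SSR) * (H ^ 2 * γ0 + 1 - A ^ 2) / (H ^ 2 * γ0 + 1)))
    (hG : Gstar = A * H *
      Real.sqrt (γ0 * SSR / ((H ^ 2 * γ0 + 1) * (H ^ 2 * γ0 + 1 - A ^ 2)))) :
    0 < Gstar ∧ Kstar < 0 ∧
    A + H * Gstar * Kstar = A / (1 + H ^ 2 * γ0) ∧
    A / (1 + H ^ 2 * γ0) ∈ Set.Ioo (0 : ℝ) 1 ∧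
    Kstar ^ 2 * (Gstar ^ 2 + SSR) / (1 - (A + H * Gstar * Kstar) ^ 2) = γ0 ∧
    (∀ G K : ℝ, 0 < G → K < 0 → (A + H * G * K) ^ 2 < 1 →
      K ^ 2 * (G ^ 2 + SSR) / (1 - (A + H * G * K) ^ 2) ≤ γ0 →
      (Gstar ^ 2 * σz ^ 2 + σw ^ 2) / (1 - (A + H * Gstar * Kstar) ^ 2) ≤
        (G ^ 2 * σz ^ 2 + σw ^ 2) / (1 - (A + H * G * K) ^ 2)) ∧
    (Gstar ^ 2 * σz ^ 2 + σw ^ 2) / (1 - (A + H * Gstar * Kstar) ^ 2) =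
      σw ^ 2 * (1 + H ^ 2 * γ0) / (1 + H ^ 2 * γ0 - A ^ 2) := by
  have hS : 0 < SSR := by rw [hSSR]; positivity
  have hw : σw ^ 2 = SSR * σz ^ 2 := by rw [hSSR]; field_simp
  clear hSSR
  have hP : 0 < H ^ 2 * γ0 := by positivity
  obtain ⟨Q, hQ⟩ : ∃ Q, Q = H ^ 2 * γ0 + 1 := ⟨_, rfl⟩
  obtain ⟨R, hR⟩ : ∃ R, R = Q - A ^ 2 := ⟨_, rfl⟩
  have hQ' : 1 + H ^ 2 * γ0 = Q := by rw [hQ]; ring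
  have hQ0 : 0 < Q := by linarith
  have hR0 : 0 < R := by linarith
  have hA0 : 0 < A := by linarith
  rw [← hQ, ← hR] at hK hG
  rw [hQ', ← hR]
  have hKa : 0 < (γ0 / SSR) * R / Q := by positivity
  have hGa : 0 < γ0 * SSR / (Q * R) := by positivity
  have hK2 : Kstar ^ 2 = (γ0 / SSR) * R / Q := by
    rw [hK, neg_sq, Real.sq_sqrt hKa.le]
  have hG2 : Gstar ^ 2 = A ^ 2 * H ^ 2 * (γ0 * SSR / (Q * R)) := by
    rw [hG, mul_pow, Real.sq_sqrt hGa.le]; ring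
  have hGK : Gstar * Kstar = -(A * H * (γ0 / Q)) := by
    have h1 : Real.sqrt (γ0 * SSR / (Q * R)) * Real.sqrt ((γ0 / SSR) * R / Q) = γ0 / Q := by
      rw [← Real.sqrt_mul hGa.le, show γ0 * SSR / (Q * R) * ((γ0 / SSR) * R / Q) = (γ0 / Q) ^ 2 by
        field_simp]
      exact Real.sqrt_sq (by positivity)
    rw [hG, hK, ← h1]; ring
  have hG0 : 0 < Gstar := by
    rw [hG]; have := Real.sqrt_pos.2 hGa; positivity
  have hK0 : Kstar < 0 := by
    rw [hK]; have := Real.sqrt_pos.2 hKa; linarith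
  have hc : A + H * Gstar * Kstar = A / Q := by
    rw [mul_assoc, hGK]; field_simp; rw [hQ]; ring
  have hAQ : A < Q := by nlinarith only [hA, hR, hR0]
  have hd0 : 0 < Q ^ 2 - A ^ 2 := by nlinarith only [hAQ, hA0, hQ0]
  have hd : 1 - (A / Q) ^ 2 = (Q ^ 2 - A ^ 2) / Q ^ 2 := by field_simp
  have hGS : Gstar ^ 2 + SSR = SSR * (Q ^ 2 - A ^ 2) / (Q * R) := by
    rw [hG2]; field_simp; rw [hR, hQ]; ring
  have hJ : (Gstar ^ 2 * σz ^ 2 + σw ^ 2) / (1 - (A + H * Gstar * Kstar) ^ 2) =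
      σw ^ 2 * Q / R := by
    rw [hc, hd, hw, show Gstar ^ 2 * σz ^ 2 + SSR * σz ^ 2 = (Gstar ^ 2 + SSR) * σz ^ 2 by ring, hGS]
    have := hd0.ne'
    field_simp
  refine ⟨hG0, hK0, hc, ⟨by positivity, (div_lt_one hQ0).2 hAQ⟩, ?_, ?_, hJ⟩
  · rw [hc, hd, hK2, hGS]
    have := hd0.ne'
    field_simp
  · intro G K hGp hKn hc1 hsnr
    rw [hJ, hw]
    obtain ⟨c, hcd⟩ : ∃ c, c = A + H * G * K := ⟨_, rfl⟩
    rw [← hcd] at hc1 hsnr ⊢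
    have hdp : 0 < 1 - c ^ 2 := by linarith
    obtain ⟨j, hj⟩ : ∃ j, j = (G ^ 2 + SSR) / (1 - c ^ 2) := ⟨_, rfl⟩
    have hj0 : 0 < j := by rw [hj]; positivity
    have hjd : j * (1 - c ^ 2) = G ^ 2 + SSR := by rw [hj]; field_simp
    have hs : K ^ 2 * j ≤ γ0 := by rw [hj, ← mul_div_assoc]; exact hsnr
    have h1 : (A - c) ^ 2 * j ≤ H ^ 2 * γ0 * G ^ 2 := by
      have h2 : (A - c) ^ 2 * j = (H ^ 2 * G ^ 2) * (K ^ 2 * j) := by rw [hcd]; ring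
      rw [h2]
      have := mul_le_mul_of_nonneg_left hs (show 0 ≤ H ^ 2 * G ^ 2 by positivity)
      linarith
    have hPQ : H ^ 2 * γ0 = Q - 1 := by linarith
    rw [hPQ] at h1 hP
    have h3 : (Q - 1) * SSR ≤ j * ((Q - 1) * (1 - c ^ 2) - (A - c) ^ 2) := by
      have : G ^ 2 = j * (1 - c ^ 2) - SSR := by linarith
      rw [this] at h1
      linarith
    have h4 : Q * ((Q - 1) * (1 - c ^ 2) - (A - c) ^ 2) ≤ (Q - 1) * R := by
      rw [hR]; linarith [sq_nonneg (Q * c - A)]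
    have h5 : SSR * Q ≤ j * R := by
      have h6 := mul_le_mul_of_nonneg_left h3 hQ0.le
      have h7 := mul_le_mul_of_nonneg_left h4 hj0.le
      have h8 : (Q - 1) * (SSR * Q) ≤ (Q - 1) * (j * R) := by linarith
      exact le_of_mul_le_mul_left h8 hP
    have h9 : (G ^ 2 * σz ^ 2 + SSR * σz ^ 2) / (1 - c ^ 2) = j * σz ^ 2 := by
      rw [hj]; ring
    rw [h9, div_le_iff₀ hR0]
    have := mul_le_mul_of_nonneg_right h5 (show 0 ≤ σz ^ 2 by positivity)
    linarith
end

section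
/- (Theorem 2, power-allocation form.) Let A > 1, σ_w > 0, γ0 > 0 and channel gains H_1, …, H_M > 0 satisfy Σ_{i=1}^M (A² − 1)/H_i² < γ0. Suppose λ > 0 is such that the numbers γ_i* = max{√A/(H_i·√λ) + (A − 1)/H_i², (A² − 1)/H_i²} satisfy Σ_{i=1}^M γ_i* = γ0. Then for every allocation (γ_1, …, γ_M) with γ_i ≥ (A² − 1)/H_i² for all i and Σ_{i=1}^M γ_i ≤ γ0, one has Σ_{i=1}^M σ_w²/(1 − A/(1 + H_i²·γ_i)) ≥ Σ_{i=1}^M σ_w²/(1 − A/(1 + H_i²·γ_i*)). -/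
theorem aux_point (A σ lam H g gs : ℝ) (hA : 1 < A) (hH : 0 < H) (hlam : 0 < lam)
    (hgs : gs = max (Real.sqrt A / (H * Real.sqrt lam) + (A - 1) / H ^ 2) ((A ^ 2 - 1) / H ^ 2))
    (hg : (A ^ 2 - 1) / H ^ 2 ≤ g) :
    σ ^ 2 / (1 - A / (1 + H ^ 2 * gs)) ≤
      σ ^ 2 / (1 - A / (1 + H ^ 2 * g)) + σ ^ 2 * lam * (g - gs) := by
  have hh : 0 < H ^ 2 := by positivity
  have hAA : 0 < A * (A - 1) := mul_pos (by linarith) (by linarith)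
  have form : ∀ x : ℝ, (A ^ 2 - 1) / H ^ 2 ≤ x →
      A * (A - 1) ≤ H ^ 2 * x - (A - 1) ∧
      σ ^ 2 / (1 - A / (1 + H ^ 2 * x)) = σ ^ 2 * (1 + A / (H ^ 2 * x - (A - 1))) := by
    intro x hx
    rw [div_le_iff₀ hh] at hx
    have h1 : A * (A - 1) ≤ H ^ 2 * x - (A - 1) := by nlinarith
    refine ⟨h1, ?_⟩
    have h2 : 0 < H ^ 2 * x - (A - 1) := by linarith
    have h3 : 0 < 1 + H ^ 2 * x := by linarith
    have h4 : 1 - A / (1 + H ^ 2 * x) = (H ^ 2 * x - (A - 1)) / (1 + H ^ 2 * x) := by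
      field_simp; ring
    rw [h4, div_div_eq_mul_div, mul_div_assoc]
    congr 1
    field_simp
    ring
  have hgs' : (A ^ 2 - 1) / H ^ 2 ≤ gs := by rw [hgs]; exact le_max_right _ _
  obtain ⟨b1, e1⟩ := form g hg
  obtain ⟨b2, e2⟩ := form gs hgs'
  rw [e1, e2]
  set K := Real.sqrt A / (H * Real.sqrt lam) with hK
  have hsl : 0 < Real.sqrt lam := Real.sqrt_pos.2 hlam
  have hK0 : 0 ≤ K := by positivity
  have hKsq : lam * (H ^ 2 * K) ^ 2 = A * H ^ 2 := by
    rw [hK, mul_pow, div_pow, mul_pow, Real.sq_sqrt (by linarith), Real.sq_sqrt hlam.le]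
    field_simp
  have hK1 : H ^ 2 * K ≤ H ^ 2 * gs - (A - 1) := by
    have : K + (A - 1) / H ^ 2 ≤ gs := by rw [hgs]; exact le_max_left _ _
    have := mul_le_mul_of_nonneg_left this hh.le
    rw [mul_add, mul_div_cancel₀ _ hh.ne'] at this
    linarith
  have key : 0 ≤ (lam * (H ^ 2 * gs - (A - 1)) ^ 2 - A * H ^ 2) * (g - gs) := by
    rcases max_choice (K + (A - 1) / H ^ 2) ((A ^ 2 - 1) / H ^ 2) with h | h
    · rw [h] at hgs
      have : H ^ 2 * gs - (A - 1) = H ^ 2 * K := by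
        rw [hgs, mul_add, mul_div_cancel₀ _ hh.ne']; ring
      rw [this, hKsq]; simp
    · rw [h] at hgs
      apply mul_nonneg
      · rw [← hKsq, sub_nonneg]
        gcongr
      · linarith
  set u := H ^ 2 * g - (A - 1) with hu
  set v := H ^ 2 * gs - (A - 1) with hv
  have hu0 : 0 < u := by linarith
  have hv0 : 0 < v := by linarith
  have huv : u - v = H ^ 2 * (g - gs) := by rw [hu, hv]; ring
  have t : A / v ≤ A / u + lam * (g - gs) := by
    have i1 : A / u - A / v + A / v ^ 2 * (u - v) = A * (u - v) ^ 2 / (u * v ^ 2) := by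
      field_simp; ring
    have i2 : 0 ≤ A * (u - v) ^ 2 / (u * v ^ 2) := by
      have : 0 < A := by linarith
      positivity
    have i3 : lam * (g - gs) - A / v ^ 2 * (u - v)
        = ((lam * v ^ 2 - A * H ^ 2) * (g - gs)) / v ^ 2 := by
      rw [huv]; field_simp
    have i4 : 0 ≤ ((lam * v ^ 2 - A * H ^ 2) * (g - gs)) / v ^ 2 := by positivity
    linarith
  nlinarith [mul_le_mul_of_nonneg_left t (sq_nonneg σ)]

open Finset in
/-- Theorem 2 of the paper, power-allocation form: if `λ > 0` is such that the
water-filling-type allocation `γ_i* = max{√A/(H_i√λ) + (A-1)/H_i², (A²-1)/H_i²}`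
exhausts the SNR budget `γ0`, then it minimizes the sum cost
`Σ σw²/(1 - A/(1 + H_i²γ_i))` among all feasible allocations. -/
theorem stmt7 (M : ℕ) (A σw γ0 lam : ℝ) (H : Fin M → ℝ)
    (hA : 1 < A) (hσw : 0 < σw) (hγ0 : 0 < γ0) (hH : ∀ i, 0 < H i)
    (hfeas : ∑ i, (A ^ 2 - 1) / (H i) ^ 2 < γ0) (hlam : 0 < lam)
    (γstar : Fin M → ℝ)
    (hγstar : ∀ i, γstar i =
      max (Real.sqrt A / (H i * Real.sqrt lam) + (A - 1) / (H i) ^ 2)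
        ((A ^ 2 - 1) / (H i) ^ 2))
    (hsum : ∑ i, γstar i = γ0) :
    ∀ γ : Fin M → ℝ, (∀ i, (A ^ 2 - 1) / (H i) ^ 2 ≤ γ i) → ∑ i, γ i ≤ γ0 →
      ∑ i, σw ^ 2 / (1 - A / (1 + (H i) ^ 2 * γstar i)) ≤
        ∑ i, σw ^ 2 / (1 - A / (1 + (H i) ^ 2 * γ i)) := by
  intro γ hγ hs
  have h := Finset.sum_le_sum (s := Finset.univ) (fun i _ =>
    aux_point A σw lam (H i) (γ i) (γstar i) hA (hH i) hlam (hγstar i) (hγ i))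
  rw [Finset.sum_add_distrib, ← Finset.mul_sum, Finset.sum_sub_distrib, hsum] at h
  have : σw ^ 2 * lam * (∑ i, γ i - γ0) ≤ 0 :=
    mul_nonpos_of_nonneg_of_nonpos (by positivity) (by linarith)
  linarith
end

section
/- Let A > 1 and H > 0. On the stability interval K̃ ∈ (−(A + 1)/H, −(A − 1)/H), the function S(K̃) = K̃²/(1 − (A + H·K̃)²) satisfies S(K̃) ≥ (A² − 1)/H², with equality if and only if K̃ = −(A² − 1)/(A·H). -/
/-- On the stability interval `K̃ ∈ (-(A+1)/H, -(A-1)/H)`, the scaled SNR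
`S(K̃) = K̃²/(1 - (A + HK̃)²)` is at least `(A² - 1)/H²`, with equality iff
`K̃ = -(A² - 1)/(A H)`. -/
theorem stmt9 (A H : ℝ) (hA : 1 < A) (hH : 0 < H) :
    ∀ Kt ∈ Set.Ioo (-(A + 1) / H) (-(A - 1) / H),
      (A ^ 2 - 1) / H ^ 2 ≤ Kt ^ 2 / (1 - (A + H * Kt) ^ 2) ∧
      (Kt ^ 2 / (1 - (A + H * Kt) ^ 2) = (A ^ 2 - 1) / H ^ 2 ↔
        Kt = -(A ^ 2 - 1) / (A * H)) := by
  rintro K ⟨h1, h2⟩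
  rw [div_lt_iff₀ hH] at h1
  rw [lt_div_iff₀ hH] at h2
  have hA0 : 0 < A := by linarith
  have hD : 0 < 1 - (A + H * K) ^ 2 := by nlinarith
  have hH2 : 0 < H ^ 2 := by positivity
  have key : K ^ 2 * H ^ 2 - (A ^ 2 - 1) * (1 - (A + H * K) ^ 2)
      = (K * (A * H) + (A ^ 2 - 1)) ^ 2 := by ring
  refine ⟨?_, ?_⟩
  · rw [div_le_div_iff₀ hH2 hD]
    nlinarith [sq_nonneg (K * (A * H) + (A ^ 2 - 1))]
  · rw [div_eq_div_iff hD.ne' hH2.ne', eq_div_iff (mul_pos hA0 hH).ne', ← sub_eq_zero, key,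
      sq_eq_zero_iff, eq_neg_iff_add_eq_zero]
end

section
/- Let A > 1 and H > 0. On the open stability interval K̃ ∈ (−(A + 1)/H, −(A − 1)/H), both functions S(K̃) = K̃²/(1 − (A + H·K̃)²) and T(K̃) = 1/(1 − (A + H·K̃)²) are convex. -/
theorem aux_tangent (n g t : ℝ) (hg : 0 < g) : 2 * n * t - t ^ 2 * g ≤ n ^ 2 / g := by
  rw [le_div_iff₀ hg]
  nlinarith [sq_nonneg (n - t * g)]

theorem aux_key (a b n m g k r : ℝ) (ha : 0 ≤ a) (hb : 0 ≤ b) (hg : 0 < g) (hk : 0 < k)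
    (hr : 0 < r) (h : a * g + b * k ≤ r) :
    (a * n + b * m) ^ 2 / r ≤ a * (n ^ 2 / g) + b * (m ^ 2 / k) := by
  obtain ⟨t, ht⟩ : ∃ t, t = (a * n + b * m) / r := ⟨_, rfl⟩
  have e : (a * n + b * m) ^ 2 / r = 2 * (a * n + b * m) * t - t ^ 2 * r := by
    rw [ht]; field_simp; ring
  have h1 := mul_le_mul_of_nonneg_left (aux_tangent n g t hg) ha
  have h2 := mul_le_mul_of_nonneg_left (aux_tangent m k t hk) hb
  have h3 := mul_le_mul_of_nonneg_left h (sq_nonneg t)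
  rw [e]
  linarith

theorem aux_pos (A H x : ℝ) (hH : 0 < H)
    (hx : x ∈ Set.Ioo (-(A + 1) / H) (-(A - 1) / H)) : 0 < 1 - (A + H * x) ^ 2 := by
  obtain ⟨h1, h2⟩ := hx
  rw [div_lt_iff₀ hH] at h1
  rw [lt_div_iff₀ hH] at h2
  nlinarith

theorem aux_conc (A H x y a b : ℝ) (ha : 0 ≤ a) (hb : 0 ≤ b) (hab : a + b = 1) :
    a * (1 - (A + H * x) ^ 2) + b * (1 - (A + H * y) ^ 2)
      ≤ 1 - (A + H * (a * x + b * y)) ^ 2 := by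
  obtain rfl : b = 1 - a := by linarith
  have := mul_nonneg (mul_nonneg ha hb) (sq_nonneg (H * (x - y)))
  linarith

/-- On the open stability interval `K̃ ∈ (-(A+1)/H, -(A-1)/H)`, both the scaled SNR
`S(K̃) = K̃²/(1 - (A + HK̃)²)` and the scaled cost `T(K̃) = 1/(1 - (A + HK̃)²)`
are convex. -/
theorem stmt10 (A H : ℝ) (hA : 1 < A) (hH : 0 < H) :
    ConvexOn ℝ (Set.Ioo (-(A + 1) / H) (-(A - 1) / H))
      (fun Kt : ℝ => Kt ^ 2 / (1 - (A + H * Kt) ^ 2)) ∧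
    ConvexOn ℝ (Set.Ioo (-(A + 1) / H) (-(A - 1) / H))
      (fun Kt : ℝ => 1 / (1 - (A + H * Kt) ^ 2)) := by
  have hc := convex_Ioo (𝕜 := ℝ) (-(A + 1) / H) (-(A - 1) / H)
  refine ⟨⟨hc, ?_⟩, ⟨hc, ?_⟩⟩
  · intro x hx y hy a b ha hb hab
    have hz := aux_pos A H _ hH (hc hx hy ha hb hab)
    simp only [smul_eq_mul] at hz ⊢
    exact aux_key a b x y _ _ _ ha hb (aux_pos A H x hH hx) (aux_pos A H y hH hy) hz
      (aux_conc A H x y a b ha hb hab)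
  · intro x hx y hy a b ha hb hab
    have hz := aux_pos A H _ hH (hc hx hy ha hb hab)
    simp only [smul_eq_mul] at hz ⊢
    have := aux_key a b 1 1 _ _ _ ha hb (aux_pos A H x hH hx) (aux_pos A H y hH hy) hz
      (aux_conc A H x y a b ha hb hab)
    simpa only [mul_one, hab, one_pow] using this
end

section
/- (Proposition 1.) Let A > 1, H_1, …, H_M > 0 and γ̃0 > 0, and consider minimizing Σ_{i=1}^M 1/(1 − (A + H_i·K̃_i)²) over K̃_i ∈ (−(A + 1)/H_i, −(A − 1)/H_i) subject to Σ_{i=1}^M K̃_i²/(1 − (A + H_i·K̃_i)²) ≤ γ̃0. (a) If γ̃0 ≥ Σ_{i=1}^M A²/H_i², then K̃_i* = −A/H_i is feasible and optimal, with optimal value M. (b) If γ̃0 < Σ_{i=1}^M A²/H_i² and λ' > 0 is such that the points K̃_i* = (D_i − √(4·A²·H_i²·λ' + D_i²))/(2·A·H_i·λ') with D_i = (1 − A²)·λ' + H_i² each lie in (−(A + 1)/H_i, −(A − 1)/H_i) and satisfy Σ_{i=1}^M (K̃_i*)²/(1 − (A + H_i·K̃_i*)²) = γ̃0, then (K̃_1*,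 …, K̃_M*) is optimal. -/
theorem aux_stab {A h k : ℝ} (hh : 0 < h)
    (hk : k ∈ Set.Ioo (-(A + 1) / h) (-(A - 1) / h)) : 0 < 1 - (A + h * k) ^ 2 := by
  obtain ⟨h1, h2⟩ := hk
  rw [div_lt_iff₀ hh] at h1
  rw [lt_div_iff₀ hh] at h2
  nlinarith

theorem aux_root {A h m k : ℝ} (hA : 1 < A) (hh : 0 < h) (hm : 0 < m)
    (hk : k = (((1 - A ^ 2) * m + h ^ 2) -
          Real.sqrt (4 * A ^ 2 * h ^ 2 * m + ((1 - A ^ 2) * m + h ^ 2) ^ 2)) / (2 * A * h * m)) :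
    m * k * (1 - (A + h * k) ^ 2) + (1 + m * k ^ 2) * (A + h * k) * h = 0 := by
  have hpos : 0 < 2 * A * h * m := by positivity
  have hs := Real.sq_sqrt (show 0 ≤ 4 * A ^ 2 * h ^ 2 * m + ((1 - A ^ 2) * m + h ^ 2) ^ 2 by
    positivity)
  rw [eq_div_iff hpos.ne'] at hk
  have e : Real.sqrt (4 * A ^ 2 * h ^ 2 * m + ((1 - A ^ 2) * m + h ^ 2) ^ 2)
      = ((1 - A ^ 2) * m + h ^ 2) - k * (2 * A * h * m) := by linarith
  rw [e] at hs
  have hp2 : 0 < 4 * A * h * m := by positivity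
  apply mul_left_cancel₀ hp2.ne'
  linear_combination -hs

theorem aux_min {A h m k x : ℝ} (hA : 1 < A) (hh : 0 < h) (hm : 0 < m)
    (hs : 0 < 1 - (A + h * k) ^ 2) (hx : 0 < 1 - (A + h * x) ^ 2)
    (hr : m * k * (1 - (A + h * k) ^ 2) + (1 + m * k ^ 2) * (A + h * k) * h = 0) :
    1 / (1 - (A + h * k) ^ 2) + m * (k ^ 2 / (1 - (A + h * k) ^ 2)) ≤
    1 / (1 - (A + h * x) ^ 2) + m * (x ^ 2 / (1 - (A + h * x) ^ 2)) := by
  rw [← mul_div_assoc, ← mul_div_assoc, ← add_div, ← add_div, div_le_div_iff₀ hs hx]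
  have hn : 0 ≤ (m * (1 - (A + h * k) ^ 2) + (1 + m * k ^ 2) * h ^ 2) * (x - k) ^ 2 := by
    positivity
  have e : (1 + m * x ^ 2) * (1 - (A + h * k) ^ 2) - (1 + m * k ^ 2) * (1 - (A + h * x) ^ 2)
    = (m * (1 - (A + h * k) ^ 2) + (1 + m * k ^ 2) * h ^ 2) * (x - k) ^ 2 := by
    linear_combination 2 * (x - k) * hr
  linarith

/-- Proposition 1 of the paper (identical actuator factors): minimizing
`Σ 1/(1 - (A + H_i K̃_i)²)` over stable `K̃_i` subject to the scaled-SNR budget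
`Σ K̃_i²/(1 - (A + H_i K̃_i)²) ≤ γ̃0`.
(a) If `γ̃0 ≥ Σ A²/H_i²`, then `K̃_i* = -A/H_i` is feasible and optimal with value `M`.
(b) Otherwise, if `λ' > 0` makes the stated closed-form points stable and exhaust the
budget, then they are optimal. -/
theorem stmt11 (M : ℕ) (A γt0 : ℝ) (H : Fin M → ℝ) (hA : 1 < A) (hγt0 : 0 < γt0)
    (hH : ∀ i, 0 < H i) :
    (((∑ i, A ^ 2 / (H i) ^ 2) ≤ γt0) →
      ((∀ i, (-(A / H i)) ∈ Set.Ioo (-(A + 1) / H i) (-(A - 1) / H i)) ∧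
       (∑ i, (-(A / H i)) ^ 2 / (1 - (A + H i * (-(A / H i))) ^ 2) ≤ γt0) ∧
       ((∑ i, (1 : ℝ) / (1 - (A + H i * (-(A / H i))) ^ 2)) = (M : ℝ)) ∧
       (∀ K : Fin M → ℝ,
         (∀ i, K i ∈ Set.Ioo (-(A + 1) / H i) (-(A - 1) / H i)) →
         (∑ i, (K i) ^ 2 / (1 - (A + H i * K i) ^ 2) ≤ γt0) →
         (M : ℝ) ≤ ∑ i, 1 / (1 - (A + H i * K i) ^ 2)))) ∧
    (∀ lam' : ℝ, 0 < lam' → γt0 < (∑ i, A ^ 2 / (H i) ^ 2) →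
      ∀ Kstar : Fin M → ℝ,
      (∀ i, Kstar i =
        (((1 - A ^ 2) * lam' + (H i) ^ 2) -
          Real.sqrt (4 * A ^ 2 * (H i) ^ 2 * lam' +
            ((1 - A ^ 2) * lam' + (H i) ^ 2) ^ 2)) / (2 * A * (H i) * lam')) →
      (∀ i, Kstar i ∈ Set.Ioo (-(A + 1) / H i) (-(A - 1) / H i)) →
      (∑ i, (Kstar i) ^ 2 / (1 - (A + H i * Kstar i) ^ 2) = γt0) →
      ∀ K : Fin M → ℝ,
        (∀ i, K i ∈ Set.Ioo (-(A + 1) / H i) (-(A - 1) / H i)) →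
        (∑ i, (K i) ^ 2 / (1 - (A + H i * K i) ^ 2) ≤ γt0) →
        ∑ i, (1 : ℝ) / (1 - (A + H i * Kstar i) ^ 2) ≤
          ∑ i, 1 / (1 - (A + H i * K i) ^ 2)) := by
  have hz : ∀ i, A + H i * (-(A / H i)) = 0 := fun i => by
    have := (hH i).ne'
    field_simp
    ring
  refine ⟨fun hg => ⟨fun i => ⟨?_, ?_⟩, ?_, ?_, fun K hK _ => ?_⟩, ?_⟩
  · rw [← neg_div]
    exact div_lt_div_of_pos_right (by linarith) (hH i)
  · rw [← neg_div]
    exact div_lt_div_of_pos_right (by linarith) (hH i)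
  · simp only [hz]
    simpa [div_pow] using hg
  · simp only [hz]
    simp
  · have h1 : ∑ i : Fin M, (1 : ℝ) ≤ ∑ i, 1 / (1 - (A + H i * K i) ^ 2) := by
      refine Finset.sum_le_sum fun i _ => ?_
      rw [le_div_iff₀ (aux_stab (hH i) (hK i))]
      nlinarith [sq_nonneg (A + H i * K i)]
    simpa using h1
  · intro m hm _ Ks hKs hst hsum K hK hKsum
    have h1 : ∑ i, (1 / (1 - (A + H i * Ks i) ^ 2)
          + m * ((Ks i) ^ 2 / (1 - (A + H i * Ks i) ^ 2))) ≤
        ∑ i, (1 / (1 - (A + H i * K i) ^ 2)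
          + m * ((K i) ^ 2 / (1 - (A + H i * K i) ^ 2))) :=
      Finset.sum_le_sum fun i _ => aux_min hA (hH i) hm (aux_stab (hH i) (hst i))
        (aux_stab (hH i) (hK i)) (aux_root hA (hH i) hm (hKs i))
    rw [Finset.sum_add_distrib, Finset.sum_add_distrib, ← Finset.mul_sum, ← Finset.mul_sum,
      hsum] at h1
    have h2 := mul_le_mul_of_nonneg_left hKsum hm.le
    linarith
end

section
/- (Proposition 2.) Let A > 1, H > 0, K < 0 and SSR > 0delimit, and consider the function f(G) = (G² + SSR)/(1 − (A + H·K·G)²) on the stability interval G ∈ ((A − 1)/(H·|K|), (A + 1)/(H·|K|)). Then f attains its minimum on this interval uniquely at G* = (E − √(4·A²·H²·K²·SSR + E²))/(2·A·H·K), where E = 1 − A² + H²·K²·SSR; in particular G* lies in the interval and is positive. -/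
/-- Proposition 2 of the paper (identical controller factors): on the stability
interval `G ∈ ((A-1)/(H|K|), (A+1)/(H|K|))`, the per-plant cost
`f(G) = (G² + SSR)/(1 - (A + HKG)²)` attains its minimum uniquely at the stated
`G*`, which lies in the interval and is positive. -/
theorem stmt12 (A H K SSR E Gstar : ℝ) (hA : 1 < A) (hH : 0 < H) (hK : K < 0)
    (hSSR : 0 < SSR)
    (hE : E = 1 - A ^ 2 + H ^ 2 * K ^ 2 * SSR)
    (hGstar : Gstar =
      (E - Real.sqrt (4 * A ^ 2 * H ^ 2 * K ^ 2 * SSR + E ^ 2)) / (2 * A * H * K)) :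
    Gstar ∈ Set.Ioo ((A - 1) / (H * |K|)) ((A + 1) / (H * |K|)) ∧ 0 < Gstar ∧
    (∀ G ∈ Set.Ioo ((A - 1) / (H * |K|)) ((A + 1) / (H * |K|)),
      (Gstar ^ 2 + SSR) / (1 - (A + H * K * Gstar) ^ 2) ≤
        (G ^ 2 + SSR) / (1 - (A + H * K * G) ^ 2)) ∧
    (∀ G ∈ Set.Ioo ((A - 1) / (H * |K|)) ((A + 1) / (H * |K|)), G ≠ Gstar →
      (Gstar ^ 2 + SSR) / (1 - (A + H * K * Gstar) ^ 2) <
        (G ^ 2 + SSR) / (1 - (A + H * K * G) ^ 2)) := by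
  have hc : 0 < -(H * K) := by nlinarith [mul_pos hH (neg_pos.2 hK)]
  have habs : H * |K| = -(H * K) := by rw [abs_of_neg hK]; ring
  obtain ⟨c, hcdef⟩ : ∃ c, c = -(H * K) := ⟨_, rfl⟩
  rw [habs, ← hcdef]
  rw [← hcdef] at hc
  have hHK : H * K = -c := by rw [hcdef]; ring
  have hE' : E = 1 - A ^ 2 + c ^ 2 * SSR := by rw [hE, hcdef]; ring
  have hT : 0 < c ^ 2 * SSR := by positivity
  have hA0 : 0 < A := by linarith
  have hrad : 4 * A ^ 2 * H ^ 2 * K ^ 2 * SSR + E ^ 2 = 4 * A ^ 2 * (c ^ 2 * SSR) + E ^ 2 := by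
    rw [hcdef]; ring
  rw [hrad] at hGstar
  have hradpos : 0 < 4 * A ^ 2 * (c ^ 2 * SSR) + E ^ 2 := by positivity
  have hs := Real.sqrt_pos.2 hradpos
  have hs2 := Real.sq_sqrt hradpos.le
  set s := Real.sqrt (4 * A ^ 2 * (c ^ 2 * SSR) + E ^ 2) with hsdef
  have hx : 2 * A * (c * Gstar) = s - E := by
    have h : 2 * A * H * K = -(2 * A * c) := by rw [hcdef]; ring
    rw [hGstar, h]
    field_simp
    ring
  have hsE : s = E + 2 * A * (c * Gstar) := by linarith
  have hq : A * (c * Gstar) ^ 2 + E * (c * Gstar) - c ^ 2 * SSR * A = 0 := by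
    have h : 4 * A * (A * (c * Gstar) ^ 2 + E * (c * Gstar) - c ^ 2 * SSR * A) = 0 := by
      rw [hsE] at hs2
      linarith
    rcases mul_eq_zero.1 h with h | h
    · linarith
    · exact h
  have hlow : A - 1 < c * Gstar := by
    by_contra! h
    have h1 : 2 * A * (A - 1) + E ≥ s := by nlinarith
    have h2 : (2 * A * (A - 1) + E) ^ 2 ≥ s ^ 2 := by gcongr
    have h3 : (2 * A * (A - 1) + E) ^ 2 - s ^ 2 = 4 * A * (-(A - 1) ^ 2 - c ^ 2 * SSR) := by
      rw [hs2, hE']; ring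
    have h4 : 0 < A * ((A - 1) ^ 2 + c ^ 2 * SSR) := by positivity
    linarith
  have hup : c * Gstar < A + 1 := by
    have h3 : (2 * A * (A + 1) + E) ^ 2 - s ^ 2 = 4 * A * ((A + 1) ^ 2 + c ^ 2 * SSR) := by
      rw [hs2, hE']; ring
    have h4 : 0 < A * ((A + 1) ^ 2 + c ^ 2 * SSR) := by positivity
    have h5 : 0 < 2 * A * (A + 1) + E := by rw [hE']; nlinarith
    have h6 : s < 2 * A * (A + 1) + E := lt_of_pow_lt_pow_left₀ 2 h5.le (by linarith)
    have h7 : 2 * A * (c * Gstar) < 2 * A * (A + 1) := by linarith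
    exact lt_of_mul_lt_mul_left h7 (by positivity)
  have hDpos : ∀ G, A - 1 < c * G → c * G < A + 1 → 0 < 1 - (A + H * K * G) ^ 2 := by
    intro G h1 h2
    rw [hHK]
    nlinarith
  have hstrict : ∀ G ∈ Set.Ioo ((A - 1) / c) ((A + 1) / c), G ≠ Gstar →
      (Gstar ^ 2 + SSR) / (1 - (A + H * K * Gstar) ^ 2) <
        (G ^ 2 + SSR) / (1 - (A + H * K * G) ^ 2) := by
    rintro G ⟨h1, h2⟩ hne
    rw [div_lt_iff₀ hc] at h1
    rw [lt_div_iff₀ hc] at h2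
    rw [div_lt_div_iff₀ (hDpos _ hlow hup) (hDpos G (by linarith) (by linarith)), hHK]
    have hpos : 0 < (c * G - c * Gstar) ^ 2 * s := by
      have : c * G - c * Gstar ≠ 0 := by
        rw [← mul_sub]; exact mul_ne_zero hc.ne' (sub_ne_zero.2 hne)
      positivity
    have hid : c ^ 2 * ((G ^ 2 + SSR) * (1 - (A + -c * Gstar) ^ 2)
        - (Gstar ^ 2 + SSR) * (1 - (A + -c * G) ^ 2)) = (c * G - c * Gstar) ^ 2 * s := by
      rw [hsE]
      rw [hE'] at hq ⊢
      linear_combination 2 * (c * G - c * Gstar) * hq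
    rw [← hid] at hpos
    have := (mul_pos_iff_of_pos_left (by positivity : 0 < c ^ 2)).1 hpos
    linarith
  refine ⟨⟨?_, ?_⟩, ?_, ?_, hstrict⟩
  · rw [div_lt_iff₀ hc]; linarith
  · rw [lt_div_iff₀ hc]; linarith
  · exact (mul_pos_iff_of_pos_left hc).1 (by linarith)
  · intro G hG
    by_cases h : G = Gstar
    · rw [h]
    · exact (hstrict G hG h).le
end

section
/- (Proposition 3.) Let A > 0 and σ_h > 0, and define Q(c) = σ_h²·c² + 2·√(2/π)·σ_h·A·c + A² for c ∈ ℝ. Then Q(c) ≥ A²·(1 − 2/π) for all c, with equality if and only if c = −A·√(2/(π·σ_h²)). Consequently, if A²·(1 − 2/π) ≥ 1, then Q(c) ≥ 1 for every c ∈ ℝ, i.e. the closed-loop second-moment gain can never be brought below 1. -/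
/-- Proposition 3 of the paper: the quadratic
`Q(c) = σh² c² + 2 √(2/π) σh A c + A²` satisfies `Q(c) ≥ A²(1 - 2/π)`, with
equality iff `c = -A √(2/(π σh²))`; hence if `A²(1 - 2/π) ≥ 1`, then `Q(c) ≥ 1`
for all `c` and the plant cannot be stabilized. -/
theorem stmt15 (A σh : ℝ) (hA : 0 < A) (hσh : 0 < σh)
    (Q : ℝ → ℝ)
    (hQ : ∀ c, Q c = σh ^ 2 * c ^ 2 +
      2 * Real.sqrt (2 / Real.pi) * σh * A * c + A ^ 2) :
    (∀ c, A ^ 2 * (1 - 2 / Real.pi) ≤ Q c) ∧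
    (∀ c, Q c = A ^ 2 * (1 - 2 / Real.pi) ↔
      c = -A * Real.sqrt (2 / (Real.pi * σh ^ 2))) ∧
    (1 ≤ A ^ 2 * (1 - 2 / Real.pi) → ∀ c, 1 ≤ Q c) := by
  have hs : Real.sqrt (2 / Real.pi) ^ 2 = 2 / Real.pi :=
    Real.sq_sqrt (by positivity)
  have hr : Real.sqrt (2 / (Real.pi * σh ^ 2)) = Real.sqrt (2 / Real.pi) / σh := by
    rw [← div_div, Real.sqrt_div (by positivity), Real.sqrt_sq hσh.le]
  have key : ∀ c, Q c = (σh * c + Real.sqrt (2 / Real.pi) * A) ^ 2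
      + A ^ 2 * (1 - 2 / Real.pi) := by
    intro c
    rw [hQ]
    linear_combination (-A ^ 2) * hs
  have h1 : ∀ c, A ^ 2 * (1 - 2 / Real.pi) ≤ Q c := by
    intro c
    rw [key]
    linarith [sq_nonneg (σh * c + Real.sqrt (2 / Real.pi) * A)]
  refine ⟨h1, ?_, fun h c => h.trans (h1 c)⟩
  intro c
  rw [key, hr, add_eq_right, sq_eq_zero_iff, ← mul_div_assoc, eq_div_iff hσh.ne']
  constructor <;> intro h <;> linarith
end

section
/- Let A > 1, σ_h > 0, SSR > 0, η = 1 − 2/π, and assume A²·η < 1. For every G > 0 and K < 0 with Q(G·K) < 1, one has SNR(G,K) = K²·(G² + SSR)/(1 − Q(G·K)) > (A² − 1)/((1 − η·A²)·σ_h²), and for every ε > 0 there exist such (G,K) with SNR(G,K) < (A² − 1)/((1 − η·A²)·σ_h²) + ε (the infimum is approached with G·K = −(A² − 1)/(A·√(2·σ_h²/π)) and K → 0⁻). Consequently, for γ0 > 0 the feasible set {(G,K) : G > 0, K < 0, Q(G·K) < 1, SNR(G,K) ≤ γ0} is nonempty if and only if A²·(1 + η·σ_h²·γ0) < 1 + σ_h²·γ0.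 -/
/-- Feasibility of the fast-fading single-plant problem (F1) with partial CSI:
over the stable region `Q(GK) < 1`, the SNR `K²(G² + SSR)/(1 - Q(GK))` is bounded
below by `(A² - 1)/((1 - ηA²)σh²)`, this bound is approached arbitrarily closely,
and hence the feasible set is nonempty iff `A²(1 + ησh²γ0) < 1 + σh²γ0`. -/
theorem stmt16 (A σh SSR γ0 η : ℝ) (hA : 1 < A) (hσh : 0 < σh) (hSSR : 0 < SSR)
    (hγ0 : 0 < γ0) (hη : η = 1 - 2 / Real.pi) (hfeasA : A ^ 2 * η < 1)
    (Q : ℝ → ℝ)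
    (hQ : ∀ u, Q u = σh ^ 2 * u ^ 2 +
      2 * Real.sqrt (2 / Real.pi) * σh * A * u + A ^ 2) :
    (∀ G K : ℝ, 0 < G → K < 0 → Q (G * K) < 1 →
      (A ^ 2 - 1) / ((1 - η * A ^ 2) * σh ^ 2) <
        K ^ 2 * (G ^ 2 + SSR) / (1 - Q (G * K))) ∧
    (∀ ε : ℝ, 0 < ε → ∃ G K : ℝ, 0 < G ∧ K < 0 ∧ Q (G * K) < 1 ∧
      K ^ 2 * (G ^ 2 + SSR) / (1 - Q (G * K)) <
        (A ^ 2 - 1) / ((1 - η * A ^ 2) * σh ^ 2) + ε) ∧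
    ((∃ G K : ℝ, 0 < G ∧ K < 0 ∧ Q (G * K) < 1 ∧
        K ^ 2 * (G ^ 2 + SSR) / (1 - Q (G * K)) ≤ γ0) ↔
      A ^ 2 * (1 + η * σh ^ 2 * γ0) < 1 + σh ^ 2 * γ0) := by
  have hs2 : Real.sqrt (2 / Real.pi) ^ 2 = 1 - η := by
    rw [Real.sq_sqrt (by positivity), hη]; ring
  have hs : 0 < Real.sqrt (2 / Real.pi) := Real.sqrt_pos.mpr (by positivity)
  generalize Real.sqrt (2 / Real.pi) = s at hQ hs2 hs
  have ha : 0 < A ^ 2 - 1 := by nlinarith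
  have hd : 0 < 1 - η * A ^ 2 := by linarith
  have hD : 0 < (1 - η * A ^ 2) * σh ^ 2 := by positivity
  have hA0 : 0 < A := by linarith
  have key : ∀ u, (A ^ 2 - 1) * (1 - Q u) =
      (1 - η * A ^ 2) * σh ^ 2 * u ^ 2 - (s * A * (σh * u) + (A ^ 2 - 1)) ^ 2 := by
    intro u
    rw [hQ]
    linear_combination (A ^ 2 * σh ^ 2 * u ^ 2) * hs2
  have h1 : ∀ G K : ℝ, 0 < G → K < 0 → Q (G * K) < 1 →
      (A ^ 2 - 1) / ((1 - η * A ^ 2) * σh ^ 2) <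
        K ^ 2 * (G ^ 2 + SSR) / (1 - Q (G * K)) := by
    intro G K hG hK hq
    rw [div_lt_div_iff₀ hD (by linarith), key]
    have : 0 < K ^ 2 * SSR * ((1 - η * A ^ 2) * σh ^ 2) := by
      have : 0 < K ^ 2 := by nlinarith
      positivity
    nlinarith [sq_nonneg (s * A * (σh * (G * K)) + (A ^ 2 - 1))]
  have h2 : ∀ ε : ℝ, 0 < ε → ∃ G K : ℝ, 0 < G ∧ K < 0 ∧ Q (G * K) < 1 ∧
      K ^ 2 * (G ^ 2 + SSR) / (1 - Q (G * K)) <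
        (A ^ 2 - 1) / ((1 - η * A ^ 2) * σh ^ 2) + ε := by
    intro ε hε
    obtain ⟨w, hw⟩ : ∃ w, w = (A ^ 2 - 1) / (s * A * σh) := ⟨_, rfl⟩
    have hw0 : 0 < w := by rw [hw]; positivity
    have hw1 : s * A * (σh * (-w)) + (A ^ 2 - 1) = 0 := by
      rw [hw]; field_simp; ring
    have hk := key (-w)
    rw [hw1] at hk
    obtain ⟨P, hP⟩ : ∃ P, P = 1 - Q (-w) := ⟨_, rfl⟩
    rw [← hP] at hk
    have hP0 : 0 < P := by
      have : 0 < (A ^ 2 - 1) * P := by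
        rw [hk]
        have : 0 < (1 - η * A ^ 2) * σh ^ 2 * w ^ 2 := by positivity
        linarith
      exact pos_of_mul_pos_right this ha.le
    obtain ⟨k, hk0, hk2⟩ : ∃ k : ℝ, 0 < k ∧ k ^ 2 = ε * P / (2 * SSR) :=
      ⟨Real.sqrt (ε * P / (2 * SSR)), Real.sqrt_pos.mpr (by positivity),
        Real.sq_sqrt (by positivity)⟩
    have hGK : w / k * (-k) = -w := by field_simp
    refine ⟨w / k, -k, by positivity, by linarith, by rw [hGK]; linarith, ?_⟩
    rw [hGK, ← hP]
    have e1 : (-k) ^ 2 * ((w / k) ^ 2 + SSR) = w ^ 2 + ε * P / 2 := by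
      have : (-k) ^ 2 * ((w / k) ^ 2 + SSR) = w ^ 2 + k ^ 2 * SSR := by field_simp
      rw [this, hk2]; field_simp
    have e2 : (A ^ 2 - 1) / ((1 - η * A ^ 2) * σh ^ 2) = w ^ 2 / P := by
      rw [div_eq_div_iff hD.ne' hP0.ne']
      linarith
    rw [e1, e2, add_div]
    have : ε * P / 2 / P = ε / 2 := by field_simp
    linarith
  have h3 : A ^ 2 * (1 + η * σh ^ 2 * γ0) < 1 + σh ^ 2 * γ0 ↔
      (A ^ 2 - 1) / ((1 - η * A ^ 2) * σh ^ 2) < γ0 := by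
    rw [div_lt_iff₀ hD]
    constructor <;> intro h <;> nlinarith
  refine ⟨h1, h2, ?_⟩
  rw [h3]
  constructor
  · rintro ⟨G, K, hG, hK, hq, h⟩
    exact (h1 G K hG hK hq).trans_le h
  · intro h
    obtain ⟨G, K, hG, hK, hq, h'⟩ := h2 _ (sub_pos.mpr h)
    exact ⟨G, K, hG, hK, hq, by linarith⟩
end

section
/- (Theorem 3.) Let A > 1, σ_h > 0, σ_z > 0, σ_w > 0, γ0 > 0, SSR = σ_w²/σ_z², η = 1 − 2/π, and assume the feasibility condition A²·(1 + η·σ_h²·γ0) < 1 + σ_h²·γ0. Set U* = −√(2/π)·σ_h·A·γ0/(1 + σ_h²·γ0), K* = −√(((1 − Q(U*))·γ0 − (U*)²)/SSR) and G* = U*/K*. Then G* > 0, K* < 0, Q(G*·K*) = Q(U*) < 1, SNR(G*,K*) ≤ γ0, and for every (G,K) with G > 0, K < 0, Q(G·K) < 1 and SNR(G,K) ≤ γ0 one has J(G,K) ≥ J(G*,K*) = γ0·σ_w²/((1 − Q(U*))·γ0 − (U*)²). -/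
/-- Theorem 3 of the paper: in the fast-fading single-plant scenario with partial
CSI, under the feasibility condition `A²(1 + ησh²γ0) < 1 + σh²γ0`, the stated
`(G*, K*)` (with `U* = G*K*`) is feasible and minimizes the steady-state cost
`J(G,K) = (G²σz² + σw²)/(1 - Q(GK))` over all feasible `(G,K)`, with minimum value
`γ0σw²/((1 - Q(U*))γ0 - (U*)²)`. -/
theorem stmt17 (A σh σz σw γ0 SSR η : ℝ) (hA : 1 < A) (hσh : 0 < σh)
    (hσz : 0 < σz) (hσw : 0 < σw) (hγ0 : 0 < γ0)
    (hSSR : SSR = σw ^ 2 / σz ^ 2) (hη : η = 1 - 2 / Real.pi)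
    (Q : ℝ → ℝ)
    (hQ : ∀ u, Q u = σh ^ 2 * u ^ 2 +
      2 * Real.sqrt (2 / Real.pi) * σh * A * u + A ^ 2)
    (hfeas : A ^ 2 * (1 + η * σh ^ 2 * γ0) < 1 + σh ^ 2 * γ0)
    (Ustar Kstar Gstar : ℝ)
    (hU : Ustar = -(Real.sqrt (2 / Real.pi) * σh * A * γ0) / (1 + σh ^ 2 * γ0))
    (hK : Kstar = -Real.sqrt (((1 - Q Ustar) * γ0 - Ustar ^ 2) / SSR))
    (hG : Gstar = Ustar / Kstar) :
    0 < Gstar ∧ Kstar < 0 ∧ Q (Gstar * Kstar) = Q Ustar ∧ Q Ustar < 1 ∧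
    Kstar ^ 2 * (Gstar ^ 2 + SSR) / (1 - Q (Gstar * Kstar)) ≤ γ0 ∧
    (∀ G K : ℝ, 0 < G → K < 0 → Q (G * K) < 1 →
      K ^ 2 * (G ^ 2 + SSR) / (1 - Q (G * K)) ≤ γ0 →
      (Gstar ^ 2 * σz ^ 2 + σw ^ 2) / (1 - Q (Gstar * Kstar)) ≤
        (G ^ 2 * σz ^ 2 + σw ^ 2) / (1 - Q (G * K))) ∧
    (Gstar ^ 2 * σz ^ 2 + σw ^ 2) / (1 - Q (Gstar * Kstar)) =
      γ0 * σw ^ 2 / ((1 - Q Ustar) * γ0 - Ustar ^ 2) := by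
  have hpi := Real.pi_pos
  have hc0 : 0 < Real.sqrt (2 / Real.pi) := Real.sqrt_pos.mpr (by positivity)
  have hc2 : Real.sqrt (2 / Real.pi) ^ 2 = 2 / Real.pi := Real.sq_sqrt (by positivity)
  rw [← hc2] at hη
  generalize Real.sqrt (2 / Real.pi) = c at *
  have hA0 : 0 < A := by linarith
  have hS : 0 < SSR := by rw [hSSR]; positivity
  have hw : σw ^ 2 = SSR * σz ^ 2 := by rw [hSSR]; field_simp
  have hD : 0 < 1 + σh ^ 2 * γ0 := by positivity
  have hUD : Ustar * (1 + σh ^ 2 * γ0) = -(c * σh * A * γ0) := by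
    rw [hU]; field_simp
  have hUneg : Ustar < 0 := by
    rw [hU]; apply div_neg_of_neg_of_pos _ hD
    have : 0 < c * σh * A * γ0 := by positivity
    linarith
  have hmax : ∀ u, (1 - Q u) * γ0 - u ^ 2 =
      ((1 - Q Ustar) * γ0 - Ustar ^ 2) - (1 + σh ^ 2 * γ0) * (u - Ustar) ^ 2 := by
    intro u
    rw [hQ, hQ]
    linear_combination (2 * (Ustar - u)) * hUD
  have hfD : ((1 - Q Ustar) * γ0 - Ustar ^ 2) * (1 + σh ^ 2 * γ0) =
      γ0 * ((1 + σh ^ 2 * γ0) - A ^ 2 * (1 + η * σh ^ 2 * γ0)) := by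
    rw [hQ, hη]
    linear_combination (-(Ustar * (1 + σh ^ 2 * γ0)) - c * σh * A * γ0) * hUD
  have hf : 0 < (1 - Q Ustar) * γ0 - Ustar ^ 2 := by
    have h1 : 0 < γ0 * ((1 + σh ^ 2 * γ0) - A ^ 2 * (1 + η * σh ^ 2 * γ0)) :=
      mul_pos hγ0 (by linarith)
    rw [← hfD] at h1
    exact pos_of_mul_pos_left h1 hD.le
  have hQ1 : 0 < 1 - Q Ustar := by
    have h1 : 0 < (1 - Q Ustar) * γ0 := by nlinarith [sq_nonneg Ustar]
    exact pos_of_mul_pos_left h1 hγ0.le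
  have hKneg : Kstar < 0 := by
    rw [hK]; exact neg_neg_of_pos (Real.sqrt_pos.mpr (by positivity))
  have hK2 : Kstar ^ 2 * SSR = (1 - Q Ustar) * γ0 - Ustar ^ 2 := by
    rw [hK, neg_sq, Real.sq_sqrt (by positivity)]; field_simp
  have hGK : Gstar * Kstar = Ustar := by rw [hG]; field_simp [hKneg.ne]
  have hGpos : 0 < Gstar := by rw [hG]; exact div_pos_of_neg_of_neg hUneg hKneg
  have hval : (Gstar ^ 2 * σz ^ 2 + σw ^ 2) / (1 - Q (Gstar * Kstar)) =
      γ0 * σw ^ 2 / ((1 - Q Ustar) * γ0 - Ustar ^ 2) := by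
    rw [hGK, div_eq_div_iff hQ1.ne' hf.ne', hw]
    have hGK2 : Gstar ^ 2 * Kstar ^ 2 = Ustar ^ 2 := by rw [← hGK]; ring
    linear_combination (-(Gstar ^ 2 * σz ^ 2)) * hK2 + (SSR * σz ^ 2) * hGK2
  refine ⟨hGpos, hKneg, by rw [hGK], by linarith, ?_, ?_, hval⟩
  · rw [hGK, div_le_iff₀ hQ1]
    have hGK2 : Gstar ^ 2 * Kstar ^ 2 = Ustar ^ 2 := by rw [← hGK]; ring
    linarith
  · intro G K hG0 hK0 hq hsnr
    have hq' : 0 < 1 - Q (G * K) := by linarith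
    rw [div_le_iff₀ hq'] at hsnr
    have hm := hmax (G * K)
    have hn : 0 ≤ (1 + σh ^ 2 * γ0) * (G * K - Ustar) ^ 2 := by positivity
    rw [hval, div_le_div_iff₀ hf hq', hw]
    generalize (1 - Q Ustar) * γ0 - Ustar ^ 2 = F at *
    generalize 1 - Q (G * K) = q at *
    have h1 : K ^ 2 * SSR ≤ q * γ0 - (G * K) ^ 2 := by linarith
    have h2 : q * γ0 - (G * K) ^ 2 ≤ F := by linarith
    have h3 : (G ^ 2 + SSR) * (q * γ0 - (G * K) ^ 2) ≤ (G ^ 2 + SSR) * F :=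
      mul_le_mul_of_nonneg_left h2 (by positivity)
    have h4 : G ^ 2 * (K ^ 2 * SSR) ≤ G ^ 2 * (q * γ0 - (G * K) ^ 2) :=
      mul_le_mul_of_nonneg_left h1 (by positivity)
    have h5 : γ0 * SSR * q ≤ (G ^ 2 + SSR) * F := by linarith
    have h6 := mul_le_mul_of_nonneg_left h5 (sq_nonneg σz)
    linarith
end
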